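/- arXiv:1512.04702 — 2 statements merged into one kernel-verified Lean document; each statement's English description precedes it below -/
import Mathlib

section
/- Under the stated hypotheses, if in addition φ is strongly convex (i.e., μ-strongly convex for some μ > 0), then the trajectory x(t) converges strongly (in norm) as t → +∞ to the unique element z of S. -/
open Filter MeasureTheory Set RealInnerProductSpace

section ConvexGradient

variable {E : Type*} [NormedAddCommGroup E]

/-- The first-order characterization of convexity: a convex function lies above its tangents. -/
theorem ConvexOn.add_hasFDerivAt_le [NormedSpace ℝ E] {f : E → ℝ} {f' : E →L[ℝ] ℝ} {a : E}
    (hf : ConvexOn ℝ univ f) (hf' : HasFDerivAt f f' a) (b : E) : f a + f' (b - a) ≤ f b := by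
  have hline : HasDerivAt (fun s : ℝ => a + s • (b - a)) (b - a) 0 := by
    simpa using ((hasDerivAt_id (0 : ℝ)).smul_const (b - a)).const_add a
  have hderiv : HasDerivAt (fun s : ℝ => f (a + s • (b - a))) (f' (b - a)) 0 :=
    HasFDerivAt.comp_hasDerivAt (0 : ℝ) (by simpa using hf') hline
  have hconv : ConvexOn ℝ univ (fun s : ℝ => f (a + s • (b - a))) := by
    have h := hf.comp_affineMap (AffineMap.lineMap (k := ℝ) a b)
    simpa [Function.comp_def, AffineMap.lineMap_apply, add_comm] using h
  have h := hconv.le_slope_of_hasDerivAt (mem_univ 0) (mem_univ 1) one_pos hderiv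
  simp only [slope_def_field, one_smul, zero_smul, add_zero, add_sub_cancel, sub_zero,
    div_one] at h
  linarith

variable [InnerProductSpace ℝ E] [CompleteSpace E] {f : E → ℝ}

theorem ConvexOn.add_inner_gradient_le (hf : ConvexOn ℝ univ f) (hd : Differentiable ℝ f)
    (a b : E) : f a + ⟪gradient f a, b - a⟫ ≤ f b := by
  simpa using hf.add_hasFDerivAt_le (hd a).hasGradientAt.hasFDerivAt b

/-- The gradient of a `μ`-strongly convex function is `μ`-strongly monotone. -/
theorem inner_gradient_sub_ge_of_convexOn_sub_norm_sq {μ : ℝ}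
    (hf : ConvexOn ℝ univ fun y => f y - μ / 2 * ‖y‖ ^ 2) (hd : Differentiable ℝ f) (a b : E) :
    μ * ‖b - a‖ ^ 2 ≤ ⟪gradient f b - gradient f a, b - a⟫ := by
  have hg (c : E) := (hd c).hasGradientAt.hasFDerivAt.fun_sub
    ((hasStrictFDerivAt_norm_sq c).hasFDerivAt.const_mul (μ / 2))
  have h₁ := hf.add_hasFDerivAt_le (hg a) b
  have h₂ := hf.add_hasFDerivAt_le (hg b) a
  simp only [sub_apply, smul_apply, InnerProductSpace.toDual_apply_apply, innerSL_apply_apply,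
    nsmul_eq_mul, smul_eq_mul, Nat.cast_ofNat] at h₁ h₂
  rw [← real_inner_self_eq_norm_sq]
  simp only [inner_sub_left, inner_sub_right, real_inner_comm a b] at h₁ h₂ ⊢
  nlinarith

/-- First-order optimality condition for a differentiable function on a convex set. -/
theorem IsMinOn.inner_gradient_nonneg {s : Set E} {a b : E} (h : IsMinOn f s a)
    (hs : Convex ℝ s) (hd : DifferentiableAt ℝ f a) (ha : a ∈ s) (hb : b ∈ s) :
    0 ≤ ⟪gradient f a, b - a⟫ := by
  have := h.localize.hasFDerivWithinAt_nonneg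
    hd.hasGradientAt.hasFDerivAt.hasFDerivWithinAt
    (sub_mem_posTangentConeAt_of_segment_subset (hs.segment_subset ha hb))
  simpa using this

theorem HasDerivWithinAt.comp_gradient {c : ℝ → E} {c' : E} {s : Set ℝ} {t : ℝ}
    (hd : DifferentiableAt ℝ f (c t)) (hc : HasDerivWithinAt c c' s t) :
    HasDerivWithinAt (fun t => f (c t)) ⟪gradient f (c t), c'⟫ s t := by
  simpa [Function.comp_def] using! hd.hasGradientAt.hasFDerivAt.comp_hasDerivWithinAt t hc

end ConvexGradient

/-- A nonnegative continuous function `F` on `[0, ∞)` is integrable as soon as a function `W`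
bounded below satisfies the dissipation inequality `W' ≤ G - δ F` with `G` integrable. -/
theorem integrableOn_Ioi_of_deriv_le_sub {W W' F G : ℝ → ℝ} {δ m : ℝ} (hδ : 0 < δ)
    (hW : ∀ t ∈ Ici (0 : ℝ), HasDerivWithinAt W (W' t) (Ici 0) t)
    (hm : ∀ t ∈ Ici (0 : ℝ), m ≤ W t)
    (hF : ContinuousOn F (Ici 0)) (hF₀ : ∀ t, 0 ≤ F t)
    (hG : IntegrableOn G (Ici 0)) (hG₀ : ∀ t, 0 ≤ G t)
    (hle : ∀ t ∈ Ici (0 : ℝ), W' t ≤ G t - δ * F t) : IntegrableOn F (Ioi 0) := by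
  have hFint (T : ℝ) : IntegrableOn F (Icc 0 T) :=
    (hF.mono Icc_subset_Ici_self).integrableOn_Icc
  refine integrableOn_Ioi_of_intervalIntegral_norm_bounded
    (δ⁻¹ * (W 0 - m + ∫ t in Ici 0, G t)) 0
    (fun T : ℝ => (hFint T).mono_set Ioc_subset_Icc_self) tendsto_id ?_
  filter_upwards [eventually_ge_atTop 0] with T hT
  have hGint : IntegrableOn G (Icc 0 T) := hG.mono_set Icc_subset_Ici_self
  have hFTC := intervalIntegral.sub_le_integral_of_hasDeriv_right_of_le hT
    (fun t ht => (hW t ht.1).continuousWithinAt.mono Icc_subset_Ici_self)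
    (fun t ht => (hW t ht.1.le).mono (Ioi_subset_Ici ht.1.le))
    (hGint.sub ((hFint T).const_mul δ)) (fun t ht => hle t ht.1.le)
  have hsplit : ∫ t in (0 : ℝ)..T, (G t - δ * F t)
      = (∫ t in (0 : ℝ)..T, G t) - δ * ∫ t in (0 : ℝ)..T, F t := by
    rw [intervalIntegral.integral_sub, intervalIntegral.integral_const_mul]
    · exact (intervalIntegrable_iff_integrableOn_Icc_of_le hT).2 hGint
    · exact (intervalIntegrable_iff_integrableOn_Icc_of_le hT).2 ((hFint T).const_mul δ)
  have hGle : ∫ t in (0 : ℝ)..T, G t ≤ ∫ t in Ici 0, G t := by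
    rw [intervalIntegral.integral_of_le hT]
    exact setIntegral_mono_set hG (ae_of_all _ hG₀)
      (Ioc_subset_Icc_self.trans Icc_subset_Ici_self).eventuallyLE
  simp only [Real.norm_of_nonneg (hF₀ _)]
  rw [le_inv_mul_iff₀ hδ]
  have := hm T hT
  simp only [Pi.sub_apply] at hFTC
  linarith

/-- The positive part of `⟪p, x - z⟫ - β ψ(x)` along a continuous curve is integrable as soon as
`β (ψ^*(p / β) - ⟪p / β, z⟫)` is. -/
theorem integrableOn_max_inner_sub {E : Type*} [NormedAddCommGroup E] [InnerProductSpace ℝ E]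
    {ψ : E → ℝ} {β : ℝ → ℝ} {x : ℝ → E} {z p : E} (hψ : Continuous ψ)
    (hβpos : ∀ t ∈ Ici (0 : ℝ), 0 < β t) (hβ : ContinuousOn β (Ici 0))
    (hx : ContinuousOn x (Ici 0))
    (h : ∫⁻ t in Ici (0 : ℝ), ⨆ w : E,
        ENNReal.ofReal (β t * ((⟪(β t)⁻¹ • p, w⟫ - ψ w) - ⟪(β t)⁻¹ • p, z⟫)) ≠ ⊤) :
    IntegrableOn (fun t => max 0 (⟪p, x t - z⟫ - β t * ψ (x t))) (Ici 0) := by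
  have hcont : ContinuousOn (fun t => max 0 (⟪p, x t - z⟫ - β t * ψ (x t))) (Ici 0) :=
    continuousOn_const.sup ((continuousOn_const.inner (hx.sub continuousOn_const)).sub
      (hβ.mul (hψ.comp_continuousOn hx)))
  refine ⟨hcont.aestronglyMeasurable measurableSet_Ici, ?_⟩
  rw [hasFiniteIntegral_iff_ofReal (ae_of_all _ fun t => by simp)]
  refine (setLIntegral_mono' measurableSet_Ici fun t ht => ?_).trans_lt h.lt_top
  refine le_trans ?_ (le_iSup _ (x t))
  have hβt := (hβpos t ht).ne'
  have heq : β t * ((⟪(β t)⁻¹ • p, x t⟫ - ψ (x t)) - ⟪(β t)⁻¹ • p, z⟫)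
      = ⟪p, x t - z⟫ - β t * ψ (x t) := by
    rw [inner_smul_left, inner_smul_left, inner_sub_right]
    simp only [conj_trivial]
    field_simp
    ring
  rw [heq]
  rcases le_total (⟪p, x t - z⟫ - β t * ψ (x t)) 0 with hn | hn
  · simp [hn]
  · simp [hn]

theorem stmt13 {H : Type*} [NormedAddCommGroup H] [InnerProductSpace ℝ H] [CompleteSpace H]
    (φ ψ : H → ℝ) (γ k : ℝ) (β β' : ℝ → ℝ) (x x' x'' : ℝ → H)
    -- ψ is convex, Fréchet differentiable with Lipschitz continuous gradient,
    -- nonnegative, and argmin ψ = ψ⁻¹(0) is nonempty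
    (hψconv : ConvexOn ℝ univ ψ)
    (hψdiff : Differentiable ℝ ψ)
    (hψlip : ∃ L : NNReal, LipschitzWith L (gradient ψ))
    (hψnonneg : ∀ y, 0 ≤ ψ y)
    (hψmin : ∃ y, ψ y = 0)
    -- φ is convex, Fréchet differentiable with Lipschitz continuous gradient,
    -- bounded from below, and S = {z ∈ argmin ψ : φ z ≤ φ y ∀ y ∈ argmin ψ} is nonempty
    (hφconv : ConvexOn ℝ univ φ)
    (hφdiff : Differentiable ℝ φ)
    (hφlip : ∃ L : NNReal, LipschitzWith L (gradient φ))
    (hφbdd : BddBelow (range φ))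
    (hS : ∃ z : H, ψ z = 0 ∧ ∀ y, ψ y = 0 → φ z ≤ φ y)
    -- γ > 0, 0 ≤ k < γ, and β : [0,∞) → (0,∞) is a C¹ function (with derivative β')
    -- satisfying the growth condition 0 ≤ β' ≤ k β
    (hγ : 0 < γ) (hk : 0 ≤ k) (hkγ : k < γ)
    (hβpos : ∀ t ∈ Ici (0 : ℝ), 0 < β t)
    (hβderiv : ∀ t ∈ Ici (0 : ℝ), HasDerivWithinAt β (β' t) (Ici 0) t)
    (hβ'cont : ContinuousOn β' (Ici 0))
    (hβgrowth : ∀ t ∈ Ici (0 : ℝ), 0 ≤ β' t ∧ β' t ≤ k * β t)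
    -- condition (H): for every p in the range of the normal cone to argmin ψ (i.e.
    -- p ∈ N(z) for some z ∈ argmin ψ = ψ⁻¹(0)), the integral
    -- ∫_0^∞ β(t) [ψ*(p/β(t)) - σ(p/β(t))] dt is finite; here σ(p/β(t)) = ⟪p/β(t), z⟫
    -- since p ∈ N(z), and β(t)[ψ*(q) - ⟪q, z⟫] = ⨆ w, β(t)((⟪q, w⟫ - ψ w) - ⟪q, z⟫) ≥ 0.
    (hH : ∀ z p : H, ψ z = 0 → (∀ y, ψ y = 0 → ⟪p, y - z⟫ ≤ 0) →
      ∫⁻ t in Ici (0 : ℝ), ⨆ w : H,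
        ENNReal.ofReal (β t * ((⟪(β t)⁻¹ • p, w⟫ - ψ w) - ⟪(β t)⁻¹ • p, z⟫)) ≠ ⊤)
    -- x : [0,∞) → H is twice continuously differentiable (first derivative x',
    -- second derivative x'') and satisfies ẍ + γ ẋ + ∇φ(x) + β ∇ψ(x) = 0 on [0,∞)
    (hx' : ∀ t ∈ Ici (0 : ℝ), HasDerivWithinAt x (x' t) (Ici 0) t)
    (hx'' : ∀ t ∈ Ici (0 : ℝ), HasDerivWithinAt x' (x'' t) (Ici 0) t)
    (hx''cont : ContinuousOn x'' (Ici 0))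
    (hode : ∀ t ∈ Ici (0 : ℝ),
      x'' t + γ • x' t + gradient φ (x t) + β t • gradient ψ (x t) = 0)
    -- φ is strongly convex: μ-strongly convex for some μ > 0
    (hstrong : ∃ μ : ℝ, 0 < μ ∧ ConvexOn ℝ univ (fun y => φ y - μ / 2 * ‖y‖ ^ 2)) :
    ∃ z : H, (ψ z = 0 ∧ ∀ y, ψ y = 0 → φ z ≤ φ y) ∧
      (∀ w : H, (ψ w = 0 ∧ ∀ y, ψ y = 0 → φ w ≤ φ y) → w = z) ∧
      Tendsto x atTop (nhds z) := by
  obtain ⟨z, hz, hzmin⟩ := hS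
  obtain ⟨μ, hμ, hμconv⟩ := hstrong
  obtain ⟨m, hm⟩ := hφbdd
  have hset : Convex ℝ {y | ψ y = 0} := by
    have h := hψconv.convex_le 0
    simpa [le_antisymm_iff, hψnonneg] using h
  have hopt {a b : H} (ha : ψ a = 0) (hamin : ∀ y, ψ y = 0 → φ a ≤ φ y) (hb : ψ b = 0) :
      0 ≤ ⟪gradient φ a, b - a⟫ :=
    IsMinOn.inner_gradient_nonneg (s := {y | ψ y = 0}) (fun y hy => hamin y hy) hset
      (hφdiff a) ha hb
  have hmono (b : H) := inner_gradient_sub_ge_of_convexOn_sub_norm_sq hμconv hφdiff z b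
  refine ⟨z, ⟨hz, hzmin⟩, ?_, ?_⟩
  · rintro w ⟨hw, hwmin⟩
    have h₁ := hopt hz hzmin hw
    have h₂ := hopt hw hwmin hz
    have h₃ := hmono w
    rw [← neg_sub w z, inner_neg_right] at h₂
    rw [inner_sub_left] at h₃
    have h₄ : ‖w - z‖ ^ 2 ≤ 0 := by
      by_contra! hpos
      have := mul_pos hμ hpos
      linarith
    have h₅ : ‖w - z‖ = 0 := pow_eq_zero_iff two_ne_zero |>.1 (le_antisymm h₄ (sq_nonneg _))
    exact sub_eq_zero.1 (norm_eq_zero.1 h₅)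
  have hxc : ContinuousOn x (Ici 0) := fun t ht => (hx' t ht).continuousWithinAt
  have hx'c : ContinuousOn x' (Ici 0) := fun t ht => (hx'' t ht).continuousWithinAt
  have hβc : ContinuousOn β (Ici 0) := fun t ht => (hβderiv t ht).continuousWithinAt
  -- The weight `a ∈ (1 / γ, 1 / k)` balances the two energies, leaving the margin `c`.
  obtain ⟨a, c, ha, hc, haγ, hak⟩ :
      ∃ a c : ℝ, 0 < a ∧ 0 < c ∧ a * γ = 1 + c ∧ a * k = 1 - c := by
    have : 0 < γ + k := by linarith
    refine ⟨2 / (γ + k), (γ - k) / (γ + k), by positivity, div_pos (by linarith) this, ?_, ?_⟩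
    · field_simp
      ring
    · field_simp
      ring
  set p : H := c⁻¹ • -gradient φ z with hp
  set F : ℝ → ℝ := fun t => ‖x' t‖ ^ 2 + ‖x t - z‖ ^ 2 with hF
  set G : ℝ → ℝ := fun t => c * max 0 (⟪p, x t - z⟫ - β t * ψ (x t)) with hG
  have hGint : IntegrableOn G (Ici 0) := by
    refine (integrableOn_max_inner_sub hψdiff.continuous hβpos hβc hxc (hH z p hz ?_)).const_mul c
    intro y hy
    rw [hp, inner_smul_left, inner_neg_left]
    have := mul_nonneg (inv_pos.2 hc).le (hopt hz hzmin hy)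
    simp only [conj_trivial]
    linarith
  have hdiff (t : ℝ) (ht : t ∈ Ici (0 : ℝ)) : HasDerivWithinAt (fun t => x t - z) (x' t) (Ici 0) t :=
    (hx' t ht).sub_const z
  set W : ℝ → ℝ := fun t => a * (1 / 2 * ‖x' t‖ ^ 2 + φ (x t) + β t * ψ (x t))
    + ⟪x' t, x t - z⟫ + γ / 2 * ‖x t - z‖ ^ 2 with hW
  have hWderiv (t : ℝ) (ht : t ∈ Ici (0 : ℝ)) := (((((((hx'' t ht).norm_sq.const_mul (1 / 2)).fun_add
    ((hx' t ht).comp_gradient (hφdiff _))).fun_add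
    ((hβderiv t ht).fun_mul ((hx' t ht).comp_gradient (hψdiff _)))).const_mul a).fun_add
    ((hx'' t ht).inner ℝ (hdiff t ht))).fun_add ((hdiff t ht).norm_sq.const_mul (γ / 2)))
  have hFcont : ContinuousOn F (Ici 0) :=
    (hx'c.norm.pow 2).add ((hxc.sub continuousOn_const).norm.pow 2)
  have hFint : IntegrableOn F (Ioi 0) := by
    refine integrableOn_Ioi_of_deriv_le_sub (W := W) (G := G) (m := a * m) (lt_min hc hμ) hWderiv
      ?_ hFcont (fun t => by positivity) hGint
      (fun t => mul_nonneg hc.le (le_max_left _ _)) ?_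
    · intro t ht
      have h₁ : m ≤ φ (x t) := hm (mem_range_self _)
      have h₂ : 0 ≤ β t * ψ (x t) := mul_nonneg (hβpos t ht).le (hψnonneg _)
      have h₃ : 0 ≤ ‖a • x' t + (x t - z)‖ ^ 2 := sq_nonneg _
      rw [norm_add_sq_real, norm_smul, Real.norm_of_nonneg ha.le, inner_smul_left] at h₃
      simp only [conj_trivial] at h₃
      have h₄ : 0 ≤ a * (a / 2 * ‖x' t‖ ^ 2 + ⟪x' t, x t - z⟫ + γ / 2 * ‖x t - z‖ ^ 2) := by
        have : a * (γ / 2 * ‖x t - z‖ ^ 2) = (1 + c) / 2 * ‖x t - z‖ ^ 2 := by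
          rw [← haγ]; ring
        nlinarith [mul_nonneg hc.le (sq_nonneg ‖x t - z‖)]
      have h₅ := nonneg_of_mul_nonneg_right h₄ ha
      have h₆ := mul_le_mul_of_nonneg_left (add_le_add h₁ h₂) ha.le
      simp only [hW]
      linarith
    · intro t ht
      have hx''eq : x'' t = -(γ • x' t) - gradient φ (x t) - β t • gradient ψ (x t) := by
        rw [← sub_eq_zero, ← hode t ht]
        abel
      have hψle := hψconv.add_inner_gradient_le hψdiff (x t) z
      rw [hz, ← neg_sub (x t) z, inner_neg_right] at hψle
      have hβψ := mul_le_mul_of_nonneg_left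
        (show ψ (x t) ≤ ⟪gradient ψ (x t), x t - z⟫ by linarith) (hβpos t ht).le
      have hgrow := mul_le_mul_of_nonneg_left
        (mul_le_mul_of_nonneg_right (hβgrowth t ht).2 (hψnonneg (x t))) ha.le
      have hmono := hmono (x t)
      rw [inner_sub_left] at hmono
      have hGle : -⟪gradient φ z, x t - z⟫ - c * (β t * ψ (x t)) ≤ G t := by
        have h := mul_le_mul_of_nonneg_left
          (le_max_right 0 (⟪p, x t - z⟫ - β t * ψ (x t))) hc.le
        refine le_trans (le_of_eq ?_) h
        rw [hp, inner_smul_left, inner_neg_left]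
        simp only [conj_trivial]
        field_simp
      have hmin₁ := mul_le_mul_of_nonneg_right (min_le_left c μ) (sq_nonneg ‖x' t‖)
      have hmin₂ := mul_le_mul_of_nonneg_right (min_le_right c μ) (sq_nonneg ‖x t - z‖)
      have hakψ : a * (k * β t * ψ (x t)) = (1 - c) * (β t * ψ (x t)) := by
        rw [← hak]; ring
      have haγx : a * (γ * ‖x' t‖ ^ 2) = (1 + c) * ‖x' t‖ ^ 2 := by
        rw [← haγ]; ring
      simp only [hF, hx''eq, inner_sub_left, inner_sub_right, inner_neg_left, inner_neg_right,
        inner_smul_left, inner_smul_right, real_inner_self_eq_norm_sq, conj_trivial,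
        real_inner_comm (x' t)] at *
      linarith
  set h : ℝ → ℝ := fun t => ‖x t - z‖ ^ 2 with hh
  have hlim : Tendsto h atTop (nhds 0) := by
    refine tendsto_zero_of_hasDerivAt_of_integrableOn_Ioi (a := 0)
      (f' := fun t => 2 * ⟪x t - z, x' t⟫)
      (fun t ht => (hdiff t (mem_Ioi.1 ht).le).norm_sq.hasDerivAt (Ici_mem_nhds ht)) ?_ ?_
    · refine hFint.mono' (((continuousOn_const.mul ((hxc.sub continuousOn_const).inner hx'c)).mono
        Ioi_subset_Ici_self).aestronglyMeasurable measurableSet_Ioi) (ae_of_all _ fun t => ?_)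
      have := abs_real_inner_le_norm (x t - z) (x' t)
      rw [Real.norm_eq_abs, abs_mul, abs_two]
      nlinarith [sq_nonneg (‖x t - z‖ - ‖x' t‖)]
    · refine hFint.mono' ((((hxc.sub continuousOn_const).norm.pow 2).mono
        Ioi_subset_Ici_self).aestronglyMeasurable measurableSet_Ioi) (ae_of_all _ fun t => ?_)
      rw [Real.norm_of_nonneg (sq_nonneg _)]
      simp only [hF]
      linarith [sq_nonneg ‖x' t‖]
  rw [tendsto_iff_norm_sub_tendsto_zero]
  simpa [hh, Real.sqrt_sq (norm_nonneg _)] using hlim.sqrt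
end

section
/- Under the stated hypotheses (condition (H) is not needed here), for every z ∈ S and every t ≥ 0 the following inequality holds: h''_z(t) + γ h'_z(t) + (1/γ) E'(t) + φ(x(t)) − φ(z) + (1 − k/γ) β(t) ψ(x(t)) ≤ 0, where h_z(t) = ½‖x(t) − z‖² and E(t) = ½‖ẋ(t)‖² + φ(x(t)) + β(t) ψ(x(t)). -/
open Filter MeasureTheory Set RealInnerProductSpace

/-- The first-order characterization of convexity: a convex function lies above its tangents. -/
theorem ConvexOn.add_inner_gradient_le_s18 {H : Type*} [NormedAddCommGroup H] [InnerProductSpace ℝ H]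
    [CompleteSpace H] {f : H → ℝ} {y : H} (hf : ConvexOn ℝ univ f)
    (hd : DifferentiableAt ℝ f y) (z : H) :
    f y + ⟪gradient f y, z - y⟫ ≤ f z := by
  have hconv : ConvexOn ℝ univ (f ∘ AffineMap.lineMap (k := ℝ) y z) := by
    simpa using hf.comp_affineMap (AffineMap.lineMap (k := ℝ) y z)
  have hderiv : HasDerivAt (f ∘ AffineMap.lineMap (k := ℝ) y z)
      ⟪gradient f y, z - y⟫ 0 := by
    have h : HasFDerivAt f (InnerProductSpace.toDual ℝ H (gradient f y))
        (AffineMap.lineMap (k := ℝ) y z 0) := by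
      simpa using hd.hasGradientAt.hasFDerivAt
    simpa using h.comp_hasDerivAt (0 : ℝ) AffineMap.hasDerivAt_lineMap
  have h := hconv.le_slope_of_hasDerivAt (mem_univ 0) (mem_univ 1) zero_lt_one hderiv
  simp only [slope_def_field, Function.comp_apply, AffineMap.lineMap_apply_one,
    AffineMap.lineMap_apply_zero, sub_zero, div_one] at h
  linarith

/-- The chain rule along a curve, in terms of the gradient. -/
theorem HasGradientAt.comp_hasDerivWithinAt {H : Type*} [NormedAddCommGroup H]
    [InnerProductSpace ℝ H] [CompleteSpace H] {f : H → ℝ} {g : H} {x : ℝ → H} {v : H} {t : ℝ}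
    {s : Set ℝ} (hf : HasGradientAt f g (x t)) (hx : HasDerivWithinAt x v s t) :
    HasDerivWithinAt (fun r => f (x r)) ⟪g, v⟫ s t :=
  hf.hasFDerivAt.comp_hasDerivWithinAt t hx

theorem stmt18 {H : Type*} [NormedAddCommGroup H] [InnerProductSpace ℝ H] [CompleteSpace H]
    (φ ψ : H → ℝ) (γ k : ℝ) (β β' : ℝ → ℝ) (x x' x'' : ℝ → H)
    -- ψ is convex, Fréchet differentiable with Lipschitz continuous gradient,
    -- nonnegative, and argmin ψ = ψ⁻¹(0) is nonempty
    (hψconv : ConvexOn ℝ univ ψ)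
    (hψdiff : Differentiable ℝ ψ)
    (hψlip : ∃ L : NNReal, LipschitzWith L (gradient ψ))
    (hψnonneg : ∀ y, 0 ≤ ψ y)
    (hψmin : ∃ y, ψ y = 0)
    -- φ is convex, Fréchet differentiable with Lipschitz continuous gradient,
    -- bounded from below, and S = {z ∈ argmin ψ : φ z ≤ φ y ∀ y ∈ argmin ψ} is nonempty
    (hφconv : ConvexOn ℝ univ φ)
    (hφdiff : Differentiable ℝ φ)
    (hφlip : ∃ L : NNReal, LipschitzWith L (gradient φ))
    (hφbdd : BddBelow (range φ))
    (hS : ∃ z : H, ψ z = 0 ∧ ∀ y, ψ y = 0 → φ z ≤ φ y)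
    -- γ > 0, 0 ≤ k < γ, and β : [0,∞) → (0,∞) is a C¹ function (with derivative β')
    -- satisfying the growth condition 0 ≤ β' ≤ k β
    (hγ : 0 < γ) (hk : 0 ≤ k) (hkγ : k < γ)
    (hβpos : ∀ t ∈ Ici (0 : ℝ), 0 < β t)
    (hβderiv : ∀ t ∈ Ici (0 : ℝ), HasDerivWithinAt β (β' t) (Ici 0) t)
    (hβ'cont : ContinuousOn β' (Ici 0))
    (hβgrowth : ∀ t ∈ Ici (0 : ℝ), 0 ≤ β' t ∧ β' t ≤ k * β t)
    -- x : [0,∞) → H is twice continuously differentiable (first derivative x',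
    -- second derivative x'') and satisfies ẍ + γ ẋ + ∇φ(x) + β ∇ψ(x) = 0 on [0,∞)
    (hx' : ∀ t ∈ Ici (0 : ℝ), HasDerivWithinAt x (x' t) (Ici 0) t)
    (hx'' : ∀ t ∈ Ici (0 : ℝ), HasDerivWithinAt x' (x'' t) (Ici 0) t)
    (hx''cont : ContinuousOn x'' (Ici 0))
    (hode : ∀ t ∈ Ici (0 : ℝ),
      x'' t + γ • x' t + gradient φ (x t) + β t • gradient ψ (x t) = 0) :
    ∀ z : H, (ψ z = 0 ∧ ∀ y, ψ y = 0 → φ z ≤ φ y) → ∀ t ∈ Ici (0 : ℝ),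
      derivWithin (derivWithin (fun s => 1 / 2 * ‖x s - z‖ ^ 2) (Ici 0)) (Ici 0) t
        + γ * derivWithin (fun s => 1 / 2 * ‖x s - z‖ ^ 2) (Ici 0) t
        + 1 / γ * derivWithin
            (fun s => 1 / 2 * ‖x' s‖ ^ 2 + φ (x s) + β s * ψ (x s)) (Ici 0) t
        + (φ (x t) - φ z) + (1 - k / γ) * (β t * ψ (x t)) ≤ 0 := by
  intro z hz t ht
  have hu : UniqueDiffOn ℝ (Ici (0 : ℝ)) := uniqueDiffOn_Ici 0
  have hh : ∀ s ∈ Ici (0 : ℝ),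
      derivWithin (fun s => 1 / 2 * ‖x s - z‖ ^ 2) (Ici 0) s = ⟪x s - z, x' s⟫ := by
    intro s hs
    rw [(((hx' s hs).sub_const z).norm_sq.const_mul (1 / 2)).derivWithin (hu s hs)]
    ring
  have hh' : derivWithin (derivWithin (fun s => 1 / 2 * ‖x s - z‖ ^ 2) (Ici 0)) (Ici 0) t
      = ⟪x t - z, x'' t⟫ + ⟪x' t, x' t⟫ := by
    rw [derivWithin_congr hh (hh t ht)]
    exact (((hx' t ht).sub_const z).inner ℝ (hx'' t ht)).derivWithin (hu t ht)
  have hE : derivWithin (fun s => 1 / 2 * ‖x' s‖ ^ 2 + φ (x s) + β s * ψ (x s)) (Ici 0) t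
      = 1 / 2 * (2 * ⟪x' t, x'' t⟫) + ⟪gradient φ (x t), x' t⟫
        + (β' t * ψ (x t) + β t * ⟪gradient ψ (x t), x' t⟫) :=
    ((((hx'' t ht).norm_sq.const_mul (1 / 2)).add
      ((hφdiff (x t)).hasGradientAt.comp_hasDerivWithinAt (hx' t ht))).add
      ((hβderiv t ht).mul
        ((hψdiff (x t)).hasGradientAt.comp_hasDerivWithinAt (hx' t ht)))).derivWithin (hu t ht)
  have hpair (v : H) : ⟪x'' t, v⟫ + γ * ⟪x' t, v⟫ + ⟪gradient φ (x t), v⟫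
      + β t * ⟪gradient ψ (x t), v⟫ = 0 := by
    simpa [inner_add_left, real_inner_smul_left] using congrArg (fun w => ⟪w, v⟫) (hode t ht)
  have hφz := hφconv.add_inner_gradient_le_s18 (hφdiff (x t)) z
  have hψz := hψconv.add_inner_gradient_le_s18 (hψdiff (x t)) z
  rw [← neg_sub, inner_neg_right] at hφz hψz
  rw [hz.1] at hψz
  have hβψ := mul_le_mul_of_nonneg_left hψz (hβpos t ht).le
  have hgrowth := mul_le_mul_of_nonneg_right (hβgrowth t ht).2 (hψnonneg (x t))
  have hE' : 1 / γ * (1 / 2 * (2 * ⟪x' t, x'' t⟫) + ⟪gradient φ (x t), x' t⟫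
        + (β' t * ψ (x t) + β t * ⟪gradient ψ (x t), x' t⟫))
      ≤ -⟪x' t, x' t⟫ + k / γ * (β t * ψ (x t)) := by
    have h := hpair (x' t)
    rw [real_inner_comm] at h
    calc _ ≤ 1 / γ * (-(γ * ⟪x' t, x' t⟫) + k * β t * ψ (x t)) := by
          refine mul_le_mul_of_nonneg_left ?_ (by positivity)
          linarith
      _ = _ := by field_simp
  have h := hpair (x t - z)
  rw [real_inner_comm (x t - z) (x'' t), real_inner_comm (x t - z) (x' t)] at h
  rw [hh', hh t ht, hE]
  linarith
end
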